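/- Fix a bipartite graph H with parts A and B, and write ε_H := 1/(100·Δ(H)) and C*_H := 100|A| + 10|A|² + 2|B|. There exists s₀ = s₀(H) such that for every integer s ≥ s₀ the following holds: if G is a graph on n vertices with n ≥ s^{C*_H} and average degree d(G) ≥ n^{1 − ε_H}, and G does not contain the complete bipartite graph K_{s,s} as a (not necessarily induced) subgraph, then G contains an induced subgraph isomorphic to H. -/

import Mathlib

open Finset

/-- The average degree `2|E|/|V|` of a finite simple graph. -/
noncomputable def avgDeg {V : Type*} [Fintype V] (G : SimpleGraph V) : ℝ :=
  2 * G.edgeSet.ncard / Fintype.card V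

/-- The degree of a vertex. -/
noncomputable def deg {V : Type*} (G : SimpleGraph V) (v : V) : ℕ :=
  (G.neighborSet v).ncard

/-- `G` contains `K_{s,s}` as a (not necessarily induced) subgraph. -/
def HasKssSubgraph {V : Type*} (G : SimpleGraph V) (s : ℕ) : Prop :=
  ∃ f : completeBipartiteGraph (Fin s) (Fin s) →g G, Function.Injective f

/-- `G` contains no cycle of length 4, even as a non-induced subgraph. -/
def C4Free {V : Type*} (G : SimpleGraph V) : Prop :=
  ¬ ∃ a b c d : V, a ≠ b ∧ a ≠ c ∧ a ≠ d ∧ b ≠ c ∧ b ≠ d ∧ c ≠ d ∧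
      G.Adj a b ∧ G.Adj b c ∧ G.Adj c d ∧ G.Adj d a

/-- The balanced subdivision of `K_h` in which every edge of `K_h` is replaced by a
path with exactly `ℓ` edges (intended for `ℓ ≥ 2`): branch vertices are `Fin h`,
and each pair `a < b` gets a path of `ℓ - 1` new internal vertices. -/
def balancedSubdivision (h ℓ : ℕ) :
    SimpleGraph (Fin h ⊕ ({p : Fin h × Fin h // p.1 < p.2} × Fin (ℓ - 1))) :=
  SimpleGraph.fromRel (fun x y =>
    match x, y with
    | Sum.inl u, Sum.inr ⟨⟨⟨a, b⟩, _⟩, i⟩ => (u = a ∧ (i : ℕ) = 0) ∨ (u = b ∧ (i : ℕ) = ℓ - 2)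
    | Sum.inr ⟨e, i⟩, Sum.inr ⟨e', j⟩ => e = e' ∧ (j : ℕ) = (i : ℕ) + 1
    | _, _ => False)

/-- `G` contains an induced proper balanced subdivision of `K_h`. -/
def HasInducedBalancedSubdivision {V : Type*} (G : SimpleGraph V) (h : ℕ) : Prop :=
  ∃ ℓ : ℕ, 2 ≤ ℓ ∧ Nonempty (balancedSubdivision h ℓ ↪g G)

/-- The number of edges of `G` with one endpoint in `A` and the other in `B`
(for disjoint `A`, `B`). -/
noncomputable def crossEdges {V : Type*} (G : SimpleGraph V) (A B : Set V) : ℕ :=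
  Set.ncard {p : V × V | p.1 ∈ A ∧ p.2 ∈ B ∧ G.Adj p.1 p.2}

/-- `G` is `d`-degenerate: every (induced) subgraph has a vertex of degree at most `d`. -/
def Degenerate {V : Type*} (G : SimpleGraph V) (d : ℕ) : Prop :=
  ∀ s : Finset V, s.Nonempty → ∃ v ∈ s, ((s : Set V) ∩ G.neighborSet v).ncard ≤ d

/-- The 1-subdivision of the multihypergraph with hyperedges `edges e`, `e : E`,
on vertex set `V`. -/
def oneSubdivision {E V : Type*} (edges : E → Finset V) : SimpleGraph (E ⊕ V) :=
  SimpleGraph.fromRel (fun x y =>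
    match x, y with
    | Sum.inl a, Sum.inr b => b ∈ edges a
    | _, _ => False)

/-- The 1-subdivision of a simple graph `G`. -/
def graphOneSubdivision {W : Type*} (G : SimpleGraph W) : SimpleGraph (G.edgeSet ⊕ W) :=
  SimpleGraph.fromRel (fun x y =>
    match x, y with
    | Sum.inl e, Sum.inr w => w ∈ (e : Sym2 W)
    | _, _ => False)

/-- `I` is an independent set of `G`. -/
def IndepSet {V : Type*} (G : SimpleGraph V) (I : Set V) : Prop :=
  I.Pairwise fun u v => ¬ G.Adj u v

/-- `G` has a clique on `k` vertices. -/
def HasClique {V : Type*} (G : SimpleGraph V) (k : ℕ) : Prop :=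
  ∃ t : Finset V, G.IsNClique k t


/-- The maximum degree of a finite simple graph. -/
noncomputable def maxDeg {V : Type*} [Fintype V] (G : SimpleGraph V) : ℕ :=
  Finset.univ.sup fun v => deg G v

section InducedEmbedding

open scoped Classical

variable {V : Type} {G : SimpleGraph V}

/-- The members of `X` that are neither equal nor adjacent to `v`. -/
noncomputable def nonNbrs (G : SimpleGraph V) (v : V) (X : Finset V) : Finset V :=
  X.filter fun x => x ≠ v ∧ ¬ G.Adj v x

lemma hasKssSubgraph_of_finsets {s : ℕ} {A B : Finset V} (hA : A.card = s) (hB : B.card = s)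
    (h : ∀ a ∈ A, ∀ b ∈ B, G.Adj a b) : HasKssSubgraph G s := by
  let eA : Fin s ≃ A := (Fintype.equivFinOfCardEq (by simpa using hA)).symm
  let eB : Fin s ≃ B := (Fintype.equivFinOfCardEq (by simpa using hB)).symm
  refine ⟨⟨Sum.elim (fun i => (eA i : V)) (fun i => (eB i : V)), ?_⟩, ?_⟩
  · rintro (i | i) (j | j) hij
    · simp at hij
    · exact h _ (eA i).2 _ (eB j).2
    · exact (h _ (eA j).2 _ (eB i).2).symm
    · simp at hij
  · rintro (i | i) (j | j) hij
    · have : (eA i : V) = eA j := hij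
      simpa using this
    · have : (eA i : V) = eB j := hij
      exact absurd (h _ (eA i).2 _ (eB j).2) (by rw [this]; exact G.loopless.irrefl _)
    · have : (eB i : V) = eA j := hij
      exact absurd (h _ (eA j).2 _ (eB i).2) (by rw [this]; exact G.loopless.irrefl _)
    · have : (eB i : V) = eB j := hij
      simpa using this

/-- The injective `k`-tuples in `X` with independent image. -/
noncomputable def indepTuples (G : SimpleGraph V) (k : ℕ) (X : Finset V) :
    Finset (Fin k → V) :=
  (Fintype.piFinset fun _ => X).filter fun a =>
    ∀ i j, i ≠ j → a i ≠ a j ∧ ¬ G.Adj (a i) (a j)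

lemma sum_card_indepTuples_le (k : ℕ) (X : Finset V) :
    ∑ v ∈ X, (indepTuples G k (nonNbrs G v X)).card ≤ (indepTuples G (k + 1) X).card := by
  rw [← Finset.card_sigma]
  refine Finset.card_le_card_of_injOn (fun p => (Fin.cons p.1 p.2 : Fin (k + 1) → V)) ?_ ?_
  · rintro ⟨v, a⟩ hva
    simp only [Finset.coe_sigma, Set.mem_sigma_iff, Finset.mem_coe, indepTuples, nonNbrs,
      Finset.mem_filter, Fintype.mem_piFinset] at hva ⊢
    obtain ⟨hv, ha, hind⟩ := hva
    refine ⟨fun i => ?_, fun i j => ?_⟩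
    · refine Fin.cases ?_ (fun i => ?_) i
      · simpa using hv
      · simpa using (ha i).1
    · refine Fin.cases ?_ (fun i => ?_) i <;> refine Fin.cases ?_ (fun j => ?_) j
      · simp
      · intro _
        simpa using ⟨(ha j).2.1.symm, (ha j).2.2⟩
      · intro _
        simpa using ⟨(ha i).2.1, fun h => (ha i).2.2 h.symm⟩
      · intro hij
        simpa using hind i j fun h => hij (h ▸ rfl)
  · rintro ⟨v, a⟩ _ ⟨w, b⟩ _ h
    obtain ⟨h1, h2⟩ := Fin.cons_inj.mp h
    subst h1; subst h2; rfl

variable [Fintype V]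

/-- The vertices whose closed neighbourhood covers all but a `1/(2s)` proportion of `X`. -/
noncomputable def heavy (G : SimpleGraph V) (s : ℕ) (X : Finset V) : Finset V :=
  Finset.univ.filter fun v => 2 * s * (nonNbrs G v X).card ≤ X.card

lemma card_heavy_lt {s : ℕ} (hs : 1 ≤ s) (hG : ¬ HasKssSubgraph G s) {X : Finset V}
    (hX : 4 * s ≤ X.card) : (heavy G s X).card < s := by
  by_contra! hcon
  obtain ⟨A, hA, hAs⟩ := Finset.exists_subset_card_eq hcon
  set Y := X.filter fun x => ∀ v ∈ A, G.Adj v x with hY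
  have hcover : X ⊆ (Y ∪ A) ∪ A.biUnion fun v => nonNbrs G v X := by
    intro x hx
    simp only [Finset.mem_union, Finset.mem_biUnion, nonNbrs, hY, Finset.mem_filter]
    by_cases hxA : x ∈ A
    · exact Or.inl (Or.inr hxA)
    by_cases hall : ∀ v ∈ A, G.Adj v x
    · exact Or.inl (Or.inl ⟨hx, hall⟩)
    push Not at hall
    obtain ⟨v, hv, hvx⟩ := hall
    exact Or.inr ⟨v, hv, hx, fun h => hxA (h ▸ hv), hvx⟩
  have h1 : X.card ≤ Y.card + A.card + ∑ v ∈ A, (nonNbrs G v X).card :=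
    (Finset.card_le_card hcover).trans <| (Finset.card_union_le _ _).trans <|
      add_le_add (Finset.card_union_le _ _) Finset.card_biUnion_le
  have h2 : 2 * s * ∑ v ∈ A, (nonNbrs G v X).card ≤ s * X.card := by
    rw [Finset.mul_sum]
    refine (Finset.sum_le_card_nsmul _ _ X.card fun v hv => ?_).trans_eq
      (by rw [hAs, smul_eq_mul])
    exact (Finset.mem_filter.mp (hA hv)).2
  have h3 : 2 * ∑ v ∈ A, (nonNbrs G v X).card ≤ X.card := by
    refine Nat.le_of_mul_le_mul_left ?_ hs
    linarith
  obtain ⟨B, hB, hBs⟩ := Finset.exists_subset_card_eq (show s ≤ Y.card by omega)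
  exact hG (hasKssSubgraph_of_finsets hAs hBs fun a ha b hb =>
    (Finset.mem_filter.mp (hB hb)).2 a ha)

/-- Large sets in a `K_{s,s}`-free graph have an independent transversal. -/
lemma exists_indep_transversal {s : ℕ} (hs : 1 ≤ s) (hG : ¬ HasKssSubgraph G s) (L : ℕ) :
    ∀ (l : ℕ) (_ : l ≤ L) (W : Fin l → Finset V),
      (∀ i, 4 * s * L * (2 * s) ^ l ≤ (W i).card) →
      ∃ w : Fin l → V, (∀ i, w i ∈ W i) ∧ ∀ i j, i ≠ j → w i ≠ w j ∧ ¬ G.Adj (w i) (w j) := by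
  intro l
  induction l with
  | zero => exact fun _ W _ => ⟨Fin.elim0, fun i => i.elim0, fun i => i.elim0⟩
  | succ l ih =>
    intro hl W hW
    have hpow : ∀ t, 1 ≤ (2 * s) ^ t := fun t => Nat.one_le_pow _ _ (by omega)
    have hbig : ∀ i, 4 * s * L ≤ (W i).card := fun i =>
      (Nat.le_mul_of_pos_right _ (hpow _)).trans (hW i)
    have hbig' : ∀ i, 4 * s ≤ (W i).card := fun i =>
      (Nat.le_mul_of_pos_right _ (by omega)).trans (hbig i)
    have hcard : (Finset.univ.biUnion fun i : Fin l => heavy G s (W i.succ)).card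
        < (W 0).card := by
      calc _ ≤ (Finset.univ : Finset (Fin l)).card * s :=
            Finset.card_biUnion_le_card_mul _ _ _ fun i _ => (card_heavy_lt hs hG (hbig' _)).le
        _ < 4 * s * L := by
          simp only [Finset.card_univ, Fintype.card_fin]
          nlinarith
        _ ≤ _ := hbig 0
    obtain ⟨v, hv, hvn⟩ := Finset.exists_mem_notMem_of_card_lt_card hcard
    have hlight : ∀ i : Fin l, (W i.succ).card < 2 * s * (nonNbrs G v (W i.succ)).card := by
      intro i
      by_contra! hle
      exact hvn (Finset.mem_biUnion.mpr ⟨i, Finset.mem_univ _,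
        Finset.mem_filter.mpr ⟨Finset.mem_univ _, hle⟩⟩)
    obtain ⟨w, hw, hind⟩ := ih (by omega) (fun i => nonNbrs G v (W i.succ)) fun i => by
      refine Nat.le_of_mul_le_mul_left ?_ (show 0 < 2 * s by omega)
      refine le_trans (le_of_eq ?_) ((hW i.succ).trans (hlight i).le)
      ring
    have hwv : ∀ i, w i ∈ W i.succ ∧ w i ≠ v ∧ ¬ G.Adj v (w i) := fun i =>
      Finset.mem_filter.mp (hw i)
    refine ⟨Fin.cons v w, ?_, ?_⟩
    · intro i
      refine Fin.cases ?_ (fun i => ?_) i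
      · simpa using hv
      · simpa using (hwv i).1
    · intro i j
      refine Fin.cases ?_ (fun i => ?_) i <;> refine Fin.cases ?_ (fun j => ?_) j
      · simp
      · intro _
        simpa using ⟨(hwv j).2.1.symm, (hwv j).2.2⟩
      · intro _
        simpa using ⟨(hwv i).2.1, fun h => (hwv i).2.2 h.symm⟩
      · intro hij
        simpa using hind i j fun h => hij (h ▸ rfl)

lemma card_pow_le_card_indepTuples {s : ℕ} (hs : 1 ≤ s) (hG : ¬ HasKssSubgraph G s) :
    ∀ (k : ℕ) (X : Finset V), 4 * s * (2 * s) ^ k ≤ X.card →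
      X.card ^ k ≤ (4 * s) ^ k ^ 2 * (indepTuples G k X).card := by
  intro k
  induction k with
  | zero =>
    intro X _
    simp [indepTuples]
  | succ k ih =>
    intro X hX
    have hpow : 1 ≤ (2 * s) ^ (k + 1) := Nat.one_le_pow _ _ (by omega)
    have h4 : 4 * s ≤ X.card := (Nat.le_mul_of_pos_right _ hpow).trans hX
    have hheavy := card_heavy_lt hs hG h4
    have hhalf : X.card ≤ 2 * (X \ heavy G s X).card := by
      have := Finset.le_card_sdiff (heavy G s X) X
      omega
    have hterm : ∀ v ∈ X \ heavy G s X, X.card ^ k ≤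
        (2 * s) ^ k * (4 * s) ^ k ^ 2 * (indepTuples G k (nonNbrs G v X)).card := by
      intro v hv
      have hlight : X.card ≤ 2 * s * (nonNbrs G v X).card := by
        by_contra! hlt
        exact (Finset.mem_sdiff.mp hv).2
          (Finset.mem_filter.mpr ⟨Finset.mem_univ _, hlt.le⟩)
      have hbig : 4 * s * (2 * s) ^ k ≤ (nonNbrs G v X).card := by
        refine Nat.le_of_mul_le_mul_left ?_ (show 0 < 2 * s by omega)
        refine le_trans (le_of_eq ?_) (hX.trans hlight)
        ring
      calc X.card ^ k ≤ (2 * s * (nonNbrs G v X).card) ^ k := Nat.pow_le_pow_left hlight k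
        _ = (2 * s) ^ k * (nonNbrs G v X).card ^ k := mul_pow _ _ _
        _ ≤ (2 * s) ^ k * ((4 * s) ^ k ^ 2 * (indepTuples G k (nonNbrs G v X)).card) :=
          Nat.mul_le_mul_left _ (ih _ hbig)
        _ = _ := by ring
    have hsum : (X \ heavy G s X).card * X.card ^ k ≤
        (2 * s) ^ k * (4 * s) ^ k ^ 2 * (indepTuples G (k + 1) X).card := by
      calc _ ≤ ∑ v ∈ X \ heavy G s X,
            (2 * s) ^ k * (4 * s) ^ k ^ 2 * (indepTuples G k (nonNbrs G v X)).card := by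
            simpa using Finset.card_nsmul_le_sum _ _ _ hterm
        _ ≤ ∑ v ∈ X,
            (2 * s) ^ k * (4 * s) ^ k ^ 2 * (indepTuples G k (nonNbrs G v X)).card :=
            Finset.sum_le_sum_of_subset Finset.sdiff_subset
        _ ≤ _ := by
          rw [← Finset.mul_sum]
          exact Nat.mul_le_mul_left _ (sum_card_indepTuples_le k X)
    have hconst : 2 * ((2 * s) ^ k * (4 * s) ^ k ^ 2) ≤ (4 * s) ^ (k + 1) ^ 2 := by
      calc 2 * ((2 * s) ^ k * (4 * s) ^ k ^ 2)
          ≤ (4 * s) * ((4 * s) ^ k * (4 * s) ^ k ^ 2) := by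
            gcongr
            · omega
            · omega
        _ = (4 * s) ^ (1 + k + k ^ 2) := by ring
        _ ≤ (4 * s) ^ (k + 1) ^ 2 := Nat.pow_le_pow_right (by omega) (by nlinarith)
    calc X.card ^ (k + 1) = X.card * X.card ^ k := by ring
      _ ≤ 2 * (X \ heavy G s X).card * X.card ^ k := Nat.mul_le_mul_right _ hhalf
      _ = 2 * ((X \ heavy G s X).card * X.card ^ k) := by ring
      _ ≤ 2 * ((2 * s) ^ k * (4 * s) ^ k ^ 2 * (indepTuples G (k + 1) X).card) :=
        Nat.mul_le_mul_left _ hsum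
      _ = 2 * ((2 * s) ^ k * (4 * s) ^ k ^ 2) * (indepTuples G (k + 1) X).card := by ring
      _ ≤ _ := Nat.mul_le_mul_right _ hconst

/-- If a set of tuples over `U` meets every line in direction `j` in at most `s` points, it has
density at most `s / |U|`. -/
lemma card_mul_card_le_of_line {k s : ℕ} {U : Finset V} {P : Finset (Fin k → V)} (j : Fin k)
    (hP : P ⊆ Fintype.piFinset fun _ => U)
    (h : ∀ c : Fin k → V, (Finset.univ.filter fun w => Function.update c j w ∈ P).card ≤ s) :
    P.card * U.card ≤ s * U.card ^ k := by
  rw [← Finset.card_product]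
  have hmaps : ∀ p ∈ P ×ˢ U, Function.update p.1 j p.2 ∈ Fintype.piFinset fun _ : Fin k => U := by
    rintro ⟨a, u⟩ hau
    obtain ⟨ha, hu⟩ := Finset.mem_product.mp hau
    rw [Fintype.mem_piFinset]
    intro i
    by_cases hij : i = j
    · subst hij; simpa using hu
    · simpa [hij] using Fintype.mem_piFinset.mp (hP ha) i
  refine (Finset.card_le_mul_card_image_of_maps_to hmaps s fun c _ => ?_).trans (by simp)
  refine (Finset.card_le_card_of_injOn (fun p => p.1 j) ?_ ?_).trans (h c)
  · rintro ⟨a, u⟩ hau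
    simp only [Finset.coe_filter, Set.mem_ofPred_eq, Finset.mem_product] at hau
    obtain ⟨⟨ha, _⟩, rfl⟩ := hau
    simpa using ha
  · rintro ⟨a, u⟩ hau ⟨b, w⟩ hbw hab
    simp only [Finset.coe_filter, Set.mem_ofPred_eq, Finset.mem_product] at hau hbw hab
    have huw := congrFun (hau.2.trans hbw.2.symm) j
    simp only [Function.update_self] at huw
    refine Prod.ext ?_ huw
    funext i
    by_cases hij : i = j
    · subst hij; exact hab
    · simpa [hij] using congrFun (hau.2.trans hbw.2.symm) i

/-- The common neighbours of `a i`, `i ∈ S`, outside the closed neighbourhoods of those `a i`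
with `i ∉ S` and `i < j`. -/
noncomputable def sieve (G : SimpleGraph V) {k : ℕ} (S : Finset (Fin k)) (a : Fin k → V) (j : ℕ) :
    Finset V :=
  Finset.univ.filter fun x =>
    (∀ i ∈ S, G.Adj (a i) x) ∧ ∀ i ∉ S, (i : ℕ) < j → x ≠ a i ∧ ¬ G.Adj (a i) x

lemma sieve_congr {k : ℕ} {S : Finset (Fin k)} {a c : Fin k → V} {j : ℕ}
    (h : ∀ i : Fin k, i ∈ S ∨ (i : ℕ) < j → a i = c i) : sieve G S a j = sieve G S c j := by
  ext x
  simp only [sieve, Finset.mem_filter, Finset.mem_univ, true_and]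
  refine and_congr (forall₂_congr fun i hi => by rw [h i (Or.inl hi)])
    (forall₃_congr fun i _ hij => by rw [h i (Or.inr hij)])

lemma sieve_succ_of_mem {k : ℕ} {S : Finset (Fin k)} {a : Fin k → V} {j : Fin k} (hj : j ∈ S) :
    sieve G S a (j + 1) = sieve G S a j := by
  ext x
  simp only [sieve, Finset.mem_filter, Finset.mem_univ, true_and]
  refine and_congr_right fun _ => forall₂_congr fun i hi => ?_
  have hne : (i : ℕ) ≠ j := fun h => hi (Fin.ext h ▸ hj)
  rw [show (i : ℕ) < j + 1 ↔ (i : ℕ) < j by omega]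

lemma sieve_succ_of_notMem {k : ℕ} {S : Finset (Fin k)} {a : Fin k → V} {j : Fin k}
    (hj : j ∉ S) : sieve G S a (j + 1) = nonNbrs G (a j) (sieve G S a j) := by
  ext x
  simp only [sieve, nonNbrs, Finset.mem_filter, Finset.mem_univ, true_and]
  constructor
  · rintro ⟨h1, h2⟩
    exact ⟨⟨h1, fun i hi hij => h2 i hi (by omega)⟩, h2 j hj (by omega)⟩
  · rintro ⟨⟨h1, h2⟩, h3⟩
    refine ⟨h1, fun i hi hij => ?_⟩
    rcases Nat.lt_succ_iff_lt_or_eq.mp hij with h | h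
    · exact h2 i hi h
    · rw [Fin.ext h]; exact h3

/-- The tuples over `U` for which the `j`-th sieving step removes too much. -/
noncomputable def stuckTuples (G : SimpleGraph V) (s : ℕ) {k : ℕ} (U : Finset V)
    (S : Finset (Fin k)) (j : Fin k) : Finset (Fin k → V) :=
  (Fintype.piFinset fun _ => U).filter fun a =>
    j ∉ S ∧ 4 * s ≤ (sieve G S a j).card ∧ a j ∈ heavy G s (sieve G S a j)

lemma card_stuckTuples_mul_le {s : ℕ} (hs : 1 ≤ s) (hG : ¬ HasKssSubgraph G s) {k : ℕ}
    (U : Finset V) (S : Finset (Fin k)) (j : Fin k) :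
    (stuckTuples G s U S j).card * U.card ≤ s * U.card ^ k := by
  refine card_mul_card_le_of_line j (Finset.filter_subset _ _) fun c => ?_
  by_cases hj : j ∈ S
  · simp [stuckTuples, hj]
  have hc : ∀ w, sieve G S (Function.update c j w) j = sieve G S c j := fun w =>
    sieve_congr fun i hi => Function.update_of_ne (by
      rintro rfl
      exact hi.elim hj (lt_irrefl _)) _ _
  by_cases h4 : 4 * s ≤ (sieve G S c j).card
  · refine (Finset.card_le_card fun w hw => ?_).trans (card_heavy_lt hs hG h4).le
    have := (Finset.mem_filter.mp (Finset.mem_filter.mp hw).2).2.2.2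
    rwa [hc, Function.update_self] at this
  · simp [stuckTuples, hc, h4]

lemma card_sieve_zero_le {s : ℕ} (hs : 1 ≤ s) {k : ℕ} {U : Finset V} {S : Finset (Fin k)}
    {a : Fin k → V} (haU : ∀ i, a i ∈ U) (ha : ∀ j, a ∉ stuckTuples G s U S j)
    (hbig : 4 * s * (2 * s) ^ k ≤ (sieve G S a 0).card) :
    ∀ j ≤ k, (sieve G S a 0).card ≤ (2 * s) ^ j * (sieve G S a j).card := by
  intro j
  induction j with
  | zero => simp
  | succ j ih =>
    intro hj
    have hprev := ih (by omega)
    by_cases hjS : (⟨j, hj⟩ : Fin k) ∈ S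
    · have := sieve_succ_of_mem (G := G) (a := a) hjS
      rw [show sieve G S a (j + 1) = sieve G S a j from this]
      refine hprev.trans (Nat.mul_le_mul_right _ (Nat.pow_le_pow_right (by omega) (by omega)))
    · have hstep := sieve_succ_of_notMem (G := G) (a := a) hjS
      simp only at hstep
      have h4 : 4 * s ≤ (sieve G S a j).card := by
        refine Nat.le_of_mul_le_mul_left (c := (2 * s) ^ j) ?_ (Nat.pow_pos (by omega))
        calc (2 * s) ^ j * (4 * s) ≤ (2 * s) ^ k * (4 * s) :=
              Nat.mul_le_mul_right _ (Nat.pow_le_pow_right (by omega) (by omega))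
          _ = 4 * s * (2 * s) ^ k := by ring
          _ ≤ _ := hbig.trans hprev
      have hlight : (sieve G S a j).card ≤ 2 * s * (sieve G S a (j + 1)).card := by
        rw [hstep]
        by_contra! hlt
        exact ha ⟨j, hj⟩ (Finset.mem_filter.mpr ⟨Fintype.mem_piFinset.mpr haU, hjS, h4,
          Finset.mem_filter.mpr ⟨Finset.mem_univ _, hlt.le⟩⟩)
      calc _ ≤ (2 * s) ^ j * (sieve G S a j).card := hprev
        _ ≤ (2 * s) ^ j * (2 * s * (sieve G S a (j + 1)).card) := Nat.mul_le_mul_left _ hlight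
        _ = _ := by ring

/-- The `S`-indexed tuples of neighbours of `v` with fewer than `m` common neighbours. -/
noncomputable def poorTuples (G : SimpleGraph V) {k : ℕ} (m : ℕ) (v : V) (S : Finset (Fin k)) :
    Finset (S → V) :=
  Finset.univ.filter fun g =>
    (Finset.univ.filter fun x => ∀ i, G.Adj (g i) x).card < m ∧ ∀ i, G.Adj (g i) v

lemma sum_card_poorTuples_le {k : ℕ} (m : ℕ) (S : Finset (Fin k)) :
    ∑ v, (poorTuples G m v S).card ≤ m * Fintype.card V ^ S.card := by
  have h := Finset.sum_card_bipartiteAbove_eq_sum_card_bipartiteBelow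
    (s := (Finset.univ : Finset V))
    (t := Finset.univ.filter fun g : S → V =>
      (Finset.univ.filter fun x => ∀ i, G.Adj (g i) x).card < m)
    (fun v g => ∀ i, G.Adj (g i) v)
  simp only [Finset.bipartiteAbove, Finset.bipartiteBelow, Finset.filter_filter] at h
  unfold poorTuples
  rw [h]
  refine (Finset.sum_le_card_nsmul _ _ m fun g hg => (Finset.mem_filter.mp hg).2.le).trans ?_
  rw [smul_eq_mul, mul_comm]
  refine Nat.mul_le_mul_left _ ((Finset.card_le_univ _).trans ?_)
  simp

lemma card_filter_sieve_lt_le {k : ℕ} (m : ℕ) (v : V) (S : Finset (Fin k)) :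
    ((Fintype.piFinset fun _ => G.neighborFinset v).filter fun a =>
      (sieve G S a 0).card < m).card ≤
      (poorTuples G m v S).card * G.degree v ^ (k - S.card) := by
  have hcard : G.degree v ^ (k - S.card) =
      (Fintype.piFinset fun _ : {i // i ∉ S} => G.neighborFinset v).card := by
    simp [Fintype.card_subtype_compl]
  rw [hcard, ← Finset.card_product]
  refine Finset.card_le_card_of_injOn
    (fun a => (fun i => a i, fun i => a i)) ?_ ?_
  · intro a ha
    simp only [Finset.coe_filter, Set.mem_ofPred_eq, Fintype.mem_piFinset,
      SimpleGraph.mem_neighborFinset] at ha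
    simp only [Finset.coe_product, Set.mem_prod, Finset.mem_coe, poorTuples, Finset.mem_filter,
      Finset.mem_univ, true_and, Fintype.mem_piFinset, SimpleGraph.mem_neighborFinset]
    refine ⟨⟨?_, fun i => (ha.1 i).symm⟩, fun i => ha.1 i⟩
    convert ha.2 using 2
    ext x
    simp [sieve]
  · intro a _ b _ hab
    obtain ⟨h1, h2⟩ := Prod.mk.inj hab
    funext i
    by_cases hi : i ∈ S
    · exact congrFun h1 ⟨i, hi⟩
    · exact congrFun h2 ⟨i, hi⟩

/-- Averaging over all vertices produces a large neighbourhood almost all of whose small tuples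
have many common neighbours. -/
lemma exists_rich_neighborhood {k l D m M : ℕ} (hD : 1 ≤ D) (S : Fin l → Finset (Fin k))
    (hS : ∀ b, (S b).card ≤ D) {r : ℝ} (hr : 0 < r) (hV : 0 < Fintype.card V)
    (hdeg : (Fintype.card V : ℝ) ^ D * r ≤ ∑ v, (G.degree v : ℝ) ^ D)
    (hm : 2 * (l * M * m : ℕ) ≤ r) :
    ∃ v, r ≤ 2 * G.degree v ∧
      ∀ b, (poorTuples G m v (S b)).card * M ≤ G.degree v ^ (S b).card := by
  set n := Fintype.card V with hn
  have hn0 : (0 : ℝ) < n := by exact_mod_cast hV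
  have hle : ∀ v, G.degree v ≤ n := fun v => (G.degree_lt_card_verts v).le
  have hpoor : ∀ b, ∑ v, (poorTuples G m v (S b)).card * G.degree v ^ (D - (S b).card) ≤
      m * n ^ D := by
    intro b
    calc _ ≤ ∑ v, (poorTuples G m v (S b)).card * n ^ (D - (S b).card) :=
          Finset.sum_le_sum fun v _ =>
            Nat.mul_le_mul_left _ (Nat.pow_le_pow_left (hle v) _)
      _ = (∑ v, (poorTuples G m v (S b)).card) * n ^ (D - (S b).card) :=
          (Finset.sum_mul _ _ _).symm
      _ ≤ m * n ^ (S b).card * n ^ (D - (S b).card) :=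
          Nat.mul_le_mul_right _ (sum_card_poorTuples_le m (S b))
      _ = m * n ^ D := by rw [mul_assoc, ← pow_add, Nat.add_sub_cancel' (hS b)]
  have hpoor' : ∑ v, ∑ b, M * ((poorTuples G m v (S b)).card * G.degree v ^ (D - (S b).card)) ≤
      l * M * m * n ^ D := by
    rw [Finset.sum_comm]
    calc _ = ∑ b, M * ∑ v, (poorTuples G m v (S b)).card * G.degree v ^ (D - (S b).card) := by
          simp_rw [Finset.mul_sum]
      _ ≤ ∑ _b : Fin l, M * (m * n ^ D) :=
          Finset.sum_le_sum fun b _ => Nat.mul_le_mul_left _ (hpoor b)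
      _ = _ := by simp; ring
  have hsum : ∑ v : V, ((n : ℝ) ^ D * r / (2 * n) +
      ((∑ b, M * ((poorTuples G m v (S b)).card * G.degree v ^ (D - (S b).card)) : ℕ) : ℝ)) ≤
      ∑ v, (G.degree v : ℝ) ^ D := by
    refine le_trans ?_ hdeg
    rw [Finset.sum_add_distrib, ← Nat.cast_sum]
    have h1 : ((∑ v, ∑ b, M * ((poorTuples G m v (S b)).card *
        G.degree v ^ (D - (S b).card)) : ℕ) : ℝ) ≤ (l * M * m : ℕ) * (n : ℝ) ^ D := by
      exact_mod_cast hpoor'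
    have h2 : ∑ _v : V, (n : ℝ) ^ D * r / (2 * n) = (n : ℝ) ^ D * r / 2 := by
      simp only [Finset.sum_const, Finset.card_univ, nsmul_eq_mul, ← hn]
      field_simp
    have h3 : 2 * (l * M * m : ℕ) * (n : ℝ) ^ D ≤ r * (n : ℝ) ^ D := by gcongr
    rw [h2]
    linarith
  have : Nonempty V := Fintype.card_pos_iff.mp hV
  obtain ⟨v, -, hv⟩ := Finset.exists_le_of_sum_le Finset.univ_nonempty hsum
  have hhalf : (n : ℝ) ^ D * r / (2 * n) ≤ (G.degree v : ℝ) ^ D :=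
    (le_add_of_nonneg_right (Nat.cast_nonneg _)).trans hv
  have hD' : D = D - 1 + 1 := by omega
  have hdn : (G.degree v : ℝ) ≤ n := by exact_mod_cast hle v
  have hrv : r ≤ 2 * G.degree v := by
    have h1 : (G.degree v : ℝ) ^ D ≤ (n : ℝ) ^ (D - 1) * G.degree v := by
      conv_lhs => rw [hD', pow_succ]
      gcongr
    have h2 : (n : ℝ) ^ D * r / (2 * n) = (n : ℝ) ^ (D - 1) * (r / 2) := by
      conv_lhs => rw [hD', pow_succ]
      field_simp
    have := le_of_mul_le_mul_left (h2 ▸ hhalf.trans h1) (pow_pos hn0 _)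
    linarith
  refine ⟨v, hrv, fun b => ?_⟩
  have hd0 : 0 < G.degree v := by
    have : (0 : ℝ) < G.degree v := by linarith
    exact_mod_cast this
  have hall : ∑ b, M * ((poorTuples G m v (S b)).card * G.degree v ^ (D - (S b).card)) ≤
      G.degree v ^ D := by
    have := (le_add_of_nonneg_left (by positivity)).trans hv
    exact_mod_cast this
  have hb := (Finset.single_le_sum (f := fun b => M * ((poorTuples G m v (S b)).card *
    G.degree v ^ (D - (S b).card))) (fun _ _ => Nat.zero_le _) (Finset.mem_univ b)).trans hall
  refine Nat.le_of_mul_le_mul_right (c := G.degree v ^ (D - (S b).card)) ?_ (Nat.pow_pos hd0)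
  rw [← pow_add, Nat.add_sub_cancel' (hS b)]
  refine le_trans (le_of_eq ?_) hb
  ring

/-- A `K_{s,s}`-free graph with large `D`-th degree moment contains every bipartite pattern whose
second side has degrees at most `D` as an induced subgraph. -/
lemma exists_induced_pattern {k l D s : ℕ} (hs : 1 ≤ s) (hG : ¬ HasKssSubgraph G s)
    (hl : 1 ≤ l) (hD : 1 ≤ D) (S : Fin l → Finset (Fin k)) (hS : ∀ b, (S b).card ≤ D)
    {r : ℝ} (hV : 0 < Fintype.card V)
    (hdeg : (Fintype.card V : ℝ) ^ D * r ≤ ∑ v, (G.degree v : ℝ) ^ D)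
    (hrich : 2 * (l * (4 * l * (4 * s) ^ k ^ 2) * (4 * s * l * (2 * s) ^ (l + k)) : ℕ) ≤ r)
    (hindep : 2 * (4 * s * (2 * s) ^ k : ℕ) ≤ r)
    (hstuck : 2 * (4 * (4 * s) ^ k ^ 2 * (l * k * s) : ℕ) ≤ r) :
    ∃ (a : Fin k → V) (w : Fin l → V),
      (∀ i j, i ≠ j → a i ≠ a j ∧ ¬ G.Adj (a i) (a j)) ∧
      (∀ b c, b ≠ c → w b ≠ w c ∧ ¬ G.Adj (w b) (w c)) ∧
      ∀ i b, a i ≠ w b ∧ (G.Adj (a i) (w b) ↔ i ∈ S b) := by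
  have hr : 0 < r := lt_of_lt_of_le (by positivity) hindep
  obtain ⟨v, hrv, hpoor⟩ := exists_rich_neighborhood hD S hS hr hV hdeg hrich
  set U := G.neighborFinset v with hU
  have hUu : U.card = G.degree v := G.card_neighborFinset_eq_degree v
  set u := G.degree v with hu
  set E := (4 * s) ^ k ^ 2 with hE
  set m := 4 * s * l * (2 * s) ^ (l + k) with hm
  have hE0 : 0 < E := Nat.pow_pos (by omega)
  have hindep' : 4 * s * (2 * s) ^ k ≤ u := by
    have : ((4 * s * (2 * s) ^ k : ℕ) : ℝ) ≤ u := by linarith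
    exact_mod_cast this
  have hstuck' : 4 * E * (l * k * s) ≤ u := by
    have : ((4 * E * (l * k * s) : ℕ) : ℝ) ≤ u := by linarith
    exact_mod_cast this
  have hu0 : 0 < u := lt_of_lt_of_le (Nat.mul_pos (by omega) (Nat.pow_pos (by omega))) hindep'
  have hI := card_pow_le_card_indepTuples hs hG k U (hUu ▸ hindep')
  rw [hUu, ← hE] at hI
  let P : Fin l → Finset (Fin k → V) := fun b =>
    (Fintype.piFinset fun _ => U).filter fun a => (sieve G (S b) a 0).card < m
  let Q : Fin l → Finset (Fin k → V) := fun b => Finset.univ.biUnion (stuckTuples G s U (S b))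
  have hP : ∀ b, (P b).card * (4 * l * E) ≤ u ^ k := by
    intro b
    have hSk : (S b).card ≤ k := by simpa using Finset.card_le_univ (S b)
    calc (P b).card * (4 * l * E)
        ≤ (poorTuples G m v (S b)).card * u ^ (k - (S b).card) * (4 * l * E) :=
          Nat.mul_le_mul_right _ (card_filter_sieve_lt_le m v (S b))
      _ = (poorTuples G m v (S b)).card * (4 * l * E) * u ^ (k - (S b).card) := by ring
      _ ≤ u ^ (S b).card * u ^ (k - (S b).card) := Nat.mul_le_mul_right _ (hpoor b)
      _ = u ^ k := by rw [← pow_add, Nat.add_sub_cancel' hSk]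
  have hPsum : 4 * E * ∑ b, (P b).card ≤ u ^ k := by
    refine Nat.le_of_mul_le_mul_left ?_ (show 0 < l by omega)
    calc l * (4 * E * ∑ b, (P b).card) = ∑ b, (P b).card * (4 * l * E) := by
          rw [← Finset.sum_mul]; ring
      _ ≤ ∑ _b : Fin l, u ^ k := Finset.sum_le_sum fun b _ => hP b
      _ = l * u ^ k := by simp
  have hQ : ∀ b, (Q b).card * u ≤ k * (s * u ^ k) := by
    intro b
    calc (Q b).card * u ≤ (∑ j, (stuckTuples G s U (S b) j).card) * u :=
          Nat.mul_le_mul_right _ Finset.card_biUnion_le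
      _ = ∑ j, (stuckTuples G s U (S b) j).card * U.card := by rw [Finset.sum_mul, hUu]
      _ ≤ ∑ _j : Fin k, s * u ^ k := Finset.sum_le_sum fun j _ => by
          simpa only [hUu] using card_stuckTuples_mul_le hs hG U (S b) j
      _ = k * (s * u ^ k) := by simp
  have hQsum : 4 * E * ∑ b, (Q b).card ≤ u ^ k := by
    refine Nat.le_of_mul_le_mul_right ?_ hu0
    calc 4 * E * (∑ b, (Q b).card) * u = 4 * E * ∑ b, (Q b).card * u := by
          rw [mul_assoc, Finset.sum_mul]
      _ ≤ 4 * E * ∑ _b : Fin l, k * (s * u ^ k) :=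
          Nat.mul_le_mul_left _ (Finset.sum_le_sum fun b _ => hQ b)
      _ = 4 * E * (l * k * s) * u ^ k := by simp; ring
      _ ≤ u * u ^ k := Nat.mul_le_mul_right _ hstuck'
      _ = u ^ k * u := mul_comm _ _
  have hbad : (Finset.univ.biUnion fun b => P b ∪ Q b).card < (indepTuples G k U).card := by
    have h1 : (Finset.univ.biUnion fun b => P b ∪ Q b).card ≤
        ∑ b, (P b).card + ∑ b, (Q b).card := by
      rw [← Finset.sum_add_distrib]
      exact Finset.card_biUnion_le.trans
        (Finset.sum_le_sum fun b _ => Finset.card_union_le _ _)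
    have hpos : 0 < u ^ k := Nat.pow_pos hu0
    refine lt_of_le_of_lt h1 (Nat.lt_of_mul_lt_mul_left (a := 4 * E) ?_)
    nlinarith
  obtain ⟨a, ha, hgood⟩ := Finset.exists_mem_notMem_of_card_lt_card hbad
  obtain ⟨haU, haind⟩ := Finset.mem_filter.mp ha
  have hgoodP : ∀ b, m ≤ (sieve G (S b) a 0).card := by
    intro b
    by_contra! hlt
    exact hgood (Finset.mem_biUnion.mpr ⟨b, Finset.mem_univ _,
      Finset.mem_union_left _ (Finset.mem_filter.mpr ⟨haU, hlt⟩)⟩)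
  have hgoodQ : ∀ b j, a ∉ stuckTuples G s U (S b) j := fun b j hj =>
    hgood (Finset.mem_biUnion.mpr ⟨b, Finset.mem_univ _,
      Finset.mem_union_right _ (Finset.mem_biUnion.mpr ⟨j, Finset.mem_univ _, hj⟩)⟩)
  have hmbig : 4 * s * (2 * s) ^ k ≤ m := by
    refine Nat.mul_le_mul (Nat.le_mul_of_pos_right _ (by omega))
      (Nat.pow_le_pow_right (by omega) (by omega))
  have hW : ∀ b, 4 * s * l * (2 * s) ^ l ≤ (sieve G (S b) a k).card := by
    intro b
    refine Nat.le_of_mul_le_mul_left (c := (2 * s) ^ k) ?_ (Nat.pow_pos (by omega))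
    refine le_trans (le_of_eq ?_) ((hgoodP b).trans (card_sieve_zero_le hs
      (Fintype.mem_piFinset.mp haU) (hgoodQ b) (hmbig.trans (hgoodP b)) k le_rfl))
    rw [hm]; ring
  obtain ⟨w, hw, hwind⟩ := exists_indep_transversal hs hG l l le_rfl _ hW
  refine ⟨a, w, haind, hwind, fun i b => ?_⟩
  obtain ⟨hin, hout⟩ := (Finset.mem_filter.mp (hw b)).2
  by_cases hi : i ∈ S b
  · exact ⟨(hin i hi).ne, iff_of_true (hin i hi) hi⟩
  · obtain ⟨hne, hadj⟩ := hout i hi i.2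
    exact ⟨hne.symm, iff_of_false hadj hi⟩

lemma sum_degree_eq_card_mul_avgDeg (G : SimpleGraph V) :
    ∑ v, (G.degree v : ℝ) = Fintype.card V * avgDeg G := by
  rcases isEmpty_or_nonempty V with hV | hV
  · simp
  have h := G.sum_degrees_eq_twice_card_edges
  have hE : G.edgeSet.ncard = G.edgeFinset.card := by
    rw [Set.ncard_eq_toFinset_card', SimpleGraph.edgeFinset]
  have hn : (Fintype.card V : ℝ) ≠ 0 := by exact_mod_cast Fintype.card_ne_zero
  rw [avgDeg, hE, mul_div_cancel₀ _ hn]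
  exact_mod_cast h

lemma avgDeg_lt_card (G : SimpleGraph V) (hV : 0 < Fintype.card V) :
    avgDeg G < Fintype.card V := by
  have hn : (0 : ℝ) < Fintype.card V := by exact_mod_cast hV
  have : Nonempty V := Fintype.card_pos_iff.mp hV
  refine lt_of_mul_lt_mul_left ?_ hn.le
  rw [← sum_degree_eq_card_mul_avgDeg]
  calc ∑ v, (G.degree v : ℝ) < ∑ _v : V, (Fintype.card V : ℝ) :=
        Finset.sum_lt_sum_of_nonempty Finset.univ_nonempty fun v _ => by
          exact_mod_cast G.degree_lt_card_verts v
    _ = _ := by simp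

lemma degree_moment_lower_bound (G : SimpleGraph V) (hV : 0 < Fintype.card V) {D : ℕ}
    (hD : 1 ≤ D)
    (h : (Fintype.card V : ℝ) ^ ((1 : ℝ) - 1 / (100 * (D : ℝ))) ≤ avgDeg G) :
    (Fintype.card V : ℝ) ^ D * (Fintype.card V : ℝ) ^ (99 / 100 : ℝ) ≤
      ∑ v, (G.degree v : ℝ) ^ D := by
  set n := Fintype.card V with hn
  have hn0 : (0 : ℝ) < n := by exact_mod_cast hV
  have hD0 : (D : ℝ) ≠ 0 := by positivity
  have hpow : (n : ℝ) ^ ((D : ℝ) - 1 / 100) ≤ avgDeg G ^ D := by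
    calc (n : ℝ) ^ ((D : ℝ) - 1 / 100)
        = ((n : ℝ) ^ ((1 : ℝ) - 1 / (100 * (D : ℝ)))) ^ D := by
          rw [← Real.rpow_natCast, ← Real.rpow_mul hn0.le]
          congr 1
          field_simp
      _ ≤ _ := pow_le_pow_left₀ (by positivity) h D
  have hmean : (n : ℝ) * avgDeg G ^ D ≤ ∑ v, (G.degree v : ℝ) ^ D := by
    obtain ⟨d, rfl⟩ : ∃ d, D = d + 1 := ⟨D - 1, by omega⟩
    have hsum := pow_sum_le_card_mul_sum_pow (s := (Finset.univ : Finset V))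
      (f := fun v => (G.degree v : ℝ)) (fun v _ => Nat.cast_nonneg _) d
    rw [sum_degree_eq_card_mul_avgDeg, Finset.card_univ, ← hn] at hsum
    refine le_of_mul_le_mul_left (le_trans (le_of_eq ?_) hsum) (pow_pos hn0 d)
    ring
  refine le_trans (le_of_eq ?_) ((mul_le_mul_of_nonneg_left hpow hn0.le).trans hmean)
  rw [← Real.rpow_natCast, ← Real.rpow_add hn0]
  nth_rewrite 2 [← Real.rpow_one (n : ℝ)]
  rw [← Real.rpow_add hn0]
  congr 1
  ring

lemma le_rpow_of_pow_le {x : ℝ} {s E F : ℕ} (hs : 1 ≤ s) (hx : (s : ℝ) ^ E ≤ x)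
    (hF : 2 * F ≤ E) : (s : ℝ) ^ F ≤ x ^ (99 / 100 : ℝ) := by
  have hs' : (1 : ℝ) ≤ s := by exact_mod_cast hs
  have hx1 : 1 ≤ x := (one_le_pow₀ hs').trans hx
  refine (sq_le_sq₀ (by positivity) (by positivity)).mp ?_
  calc ((s : ℝ) ^ F) ^ 2 = (s : ℝ) ^ (2 * F) := by ring
    _ ≤ (s : ℝ) ^ E := pow_le_pow_right₀ hs' hF
    _ ≤ x ^ (1 : ℝ) := by rwa [Real.rpow_one]
    _ ≤ x ^ (99 / 100 * (2 : ℕ) : ℝ) := Real.rpow_le_rpow_of_exponent_le hx1 (by norm_num)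
    _ = (x ^ (99 / 100 : ℝ)) ^ 2 := by rw [Real.rpow_mul (by linarith), Real.rpow_natCast]

lemma one_le_card_parts_of_one_le_maxDeg {α β : Type} [Fintype α] [Fintype β]
    {H : SimpleGraph (α ⊕ β)} (hα : ∀ a a' : α, ¬ H.Adj (Sum.inl a) (Sum.inl a'))
    (hβ : ∀ b b' : β, ¬ H.Adj (Sum.inr b) (Sum.inr b')) (hD : 1 ≤ maxDeg H) :
    1 ≤ Fintype.card α ∧ 1 ≤ Fintype.card β := by
  obtain ⟨x, -, hx⟩ := (Finset.lt_sup_iff (a := 0)).mp hD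
  obtain ⟨y, hy⟩ := Set.nonempty_of_ncard_ne_zero (Nat.ne_of_gt hx)
  have hxy : H.Adj x y := hy
  suffices Nonempty α ∧ Nonempty β from
    ⟨Fintype.card_pos_iff.mpr this.1, Fintype.card_pos_iff.mpr this.2⟩
  rcases x with x | x <;> rcases y with y | y
  · exact absurd hxy (hα _ _)
  · exact ⟨⟨x⟩, ⟨y⟩⟩
  · exact ⟨⟨y⟩, ⟨x⟩⟩
  · exact absurd hxy (hβ _ _)

lemma nonempty_embedding_of_pattern {W α β : Type} {G : SimpleGraph W} {H : SimpleGraph (α ⊕ β)}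
    (hα : ∀ a a' : α, ¬ H.Adj (Sum.inl a) (Sum.inl a'))
    (hβ : ∀ b b' : β, ¬ H.Adj (Sum.inr b) (Sum.inr b')) {f : α → W} {g : β → W}
    (hf : ∀ i j, i ≠ j → f i ≠ f j ∧ ¬ G.Adj (f i) (f j))
    (hg : ∀ i j, i ≠ j → g i ≠ g j ∧ ¬ G.Adj (g i) (g j))
    (hfg : ∀ i j, f i ≠ g j ∧ (G.Adj (f i) (g j) ↔ H.Adj (Sum.inl i) (Sum.inr j))) :
    Nonempty (H ↪g G) := by
  refine ⟨⟨⟨Sum.elim f g, ?_⟩, ?_⟩⟩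
  · refine Function.Injective.sumElim (fun i j h => ?_) (fun i j h => ?_) fun i j => (hfg i j).1
    · by_contra hij
      exact (hf i j hij).1 h
    · by_contra hij
      exact (hg i j hij).1 h
  · rintro (i | i) (j | j)
    · refine iff_of_false (fun h => ?_) (hα i j)
      by_cases hij : i = j
      · subst hij; exact h.ne rfl
      · exact (hf i j hij).2 h
    · exact (hfg i j).2
    · exact (G.adj_comm _ _).trans ((hfg j i).2.trans (H.adj_comm _ _))
    · refine iff_of_false (fun h => ?_) (hβ i j)
      by_cases hij : i = j
      · subst hij; exact h.ne rfl
      · exact (hg i j hij).2 h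

end InducedEmbedding

/-- One-sided Erdős–Hajnal: for a fixed bipartite `H` with parts `A`,
`B` and all sufficiently large `s`, every `K_{s,s}`-subgraph-free graph on
`n ≥ s^(100|A| + 10|A|² + 2|B|)` vertices with average degree at least
`n^(1 - 1/(100 Δ(H)))` contains an induced copy of `H`. -/
theorem stmt17 :
    ∀ (α β : Type) [Fintype α] [Fintype β] (H : SimpleGraph (α ⊕ β)),
      (∀ a a' : α, ¬ H.Adj (Sum.inl a) (Sum.inl a')) →
      (∀ b b' : β, ¬ H.Adj (Sum.inr b) (Sum.inr b')) →
      ∃ s₀ : ℕ, ∀ s : ℕ, s₀ ≤ s →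
        ∀ (V : Type) [Fintype V] (G : SimpleGraph V),
          (Fintype.card V : ℝ) ≥ (s : ℝ) ^
              (100 * Fintype.card α + 10 * (Fintype.card α) ^ 2 + 2 * Fintype.card β) →
          avgDeg G ≥ (Fintype.card V : ℝ) ^
              ((1 : ℝ) - 1 / (100 * (maxDeg H : ℝ))) →
          ¬ HasKssSubgraph G s →
          Nonempty (H ↪g G) := by
  intro α β _ _ H hα hβ
  classical
  set k := Fintype.card α with hk
  set l := Fintype.card β with hl
  set D := maxDeg H with hD
  refine ⟨32 * l ^ 3 * k * 4 ^ k ^ 2 * 2 ^ (l + k) + 1, fun s hs V _ G hn havg hG => ?_⟩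
  have hs1 : 1 ≤ s := by omega
  have hV : 0 < Fintype.card V := by
    have h0 : (0 : ℝ) < Fintype.card V := lt_of_lt_of_le (by positivity) hn
    exact_mod_cast h0
  have hD1 : 1 ≤ D := by
    by_contra! h0
    have h0' : D = 0 := by omega
    rw [h0'] at havg
    have hlt := avgDeg_lt_card G hV
    simp only [Nat.cast_zero, mul_zero, div_zero, sub_zero, Real.rpow_one] at havg
    linarith
  obtain ⟨hk1, hl1⟩ := one_le_card_parts_of_one_le_maxDeg hα hβ hD1
  rw [← hk] at hk1
  rw [← hl] at hl1
  let eα : α ≃ Fin k := Fintype.equivFin α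
  let eβ : β ≃ Fin l := Fintype.equivFin β
  let S : Fin l → Finset (Fin k) := fun b =>
    Finset.univ.filter fun i => H.Adj (Sum.inl (eα.symm i)) (Sum.inr (eβ.symm b))
  have hS : ∀ b, (S b).card ≤ D := by
    intro b
    refine le_trans ?_ (Finset.le_sup (f := deg H) (Finset.mem_univ (Sum.inr (eβ.symm b))))
    rw [← Set.ncard_coe_finset]
    refine Set.ncard_le_ncard_of_injOn (fun i => Sum.inl (eα.symm i)) ?_ ?_ (Set.toFinite _)
    · intro i hi
      exact (Finset.mem_filter.mp (Finset.mem_coe.mp hi)).2.symm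
    · intro i _ j _ hij
      simpa using hij
  have hr := le_rpow_of_pow_le (F := 50 * k + 5 * k ^ 2 + l) hs1 hn (by omega)
  have hbound : ∀ N c e : ℕ, N = c * s ^ e → c ≤ 32 * l ^ 3 * k * 4 ^ k ^ 2 * 2 ^ (l + k) →
      e + 1 ≤ 50 * k + 5 * k ^ 2 + l →
      (N : ℝ) ≤ (Fintype.card V : ℝ) ^ (99 / 100 : ℝ) := by
    intro N c e hN hc he
    refine le_trans ?_ hr
    have : N ≤ s ^ (50 * k + 5 * k ^ 2 + l) := by
      calc N = c * s ^ e := hN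
        _ ≤ s * s ^ e := Nat.mul_le_mul_right _ (by omega)
        _ = s ^ (e + 1) := by ring
        _ ≤ _ := Nat.pow_le_pow_right hs1 he
    exact_mod_cast this
  have h4 : 1 ≤ 4 ^ k ^ 2 := Nat.one_le_pow _ _ (by norm_num)
  have hl3 : l ≤ l ^ 3 := Nat.le_self_pow (by norm_num) l
  obtain ⟨a, w, ha, hw, haw⟩ := exists_induced_pattern hs1 hG hl1 hD1 S hS hV
    (degree_moment_lower_bound G hV hD1 havg)
    (by
      rw [← Nat.cast_ofNat, ← Nat.cast_mul]
      refine hbound _ (32 * l ^ 3 * 1 * 4 ^ k ^ 2 * 2 ^ (l + k)) (1 + k ^ 2 + l + k) ?_ ?_ ?_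
      · rw [mul_pow, mul_pow]; ring
      · gcongr
      · nlinarith)
    (by
      rw [← Nat.cast_ofNat, ← Nat.cast_mul]
      refine hbound _ (8 * 1 * 1 * 1 * 2 ^ (0 + k)) (k + 1) ?_ ?_ ?_
      · rw [mul_pow]; ring
      · gcongr
        · norm_num
        · exact hl1.trans hl3
        · norm_num
        · exact Nat.zero_le l
      · nlinarith)
    (by
      rw [← Nat.cast_ofNat, ← Nat.cast_mul]
      refine hbound _ (8 * l * k * 4 ^ k ^ 2 * 1) (k ^ 2 + 1) ?_ ?_ ?_
      · rw [mul_pow]; ring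
      · gcongr
        · norm_num
        · exact Nat.one_le_pow _ _ (by norm_num)
      · nlinarith)
  refine nonempty_embedding_of_pattern hα hβ (f := a ∘ eα) (g := w ∘ eβ)
    (fun i j hij => ha _ _ (eα.injective.ne hij)) (fun i j hij => hw _ _ (eβ.injective.ne hij))
    fun i j => ⟨(haw _ _).1, (haw _ _).2.trans ?_⟩
  simp [S]
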